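/- arXiv:1104.3663 — 2 statements merged into one kernel-verified Lean document; each statement's English description precedes it below -/
import Mathlib

section
/- Let h : ℝ → ℝ be 2π-periodic, Lipschitz, with min h > 0, and satisfying h'' + h ≥ 0 in the distributional sense. Then there exists a constant C = C(h) > 0 such that for every 2π-periodic C^∞ function v : ℝ → ℝ, the second derivative of the Mahler functional, namely Q(v) := B(h)·∫₀^{2π}(v² − v'²) dθ − 2·(∫₀^{2π}(h v − h' v') dθ)·(∫₀^{2π} v/h³ dθ) + 3·A(h)·∫₀^{2π} v²/h⁴ dθ, satisfies Q(v) ≤ C·‖v‖_{L^∞}·‖v‖_{L¹} − B(h)·∫₀^{2π} v'² dθ, where B(h) > 0. -/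
open MeasureTheory Real Set intervalIntegral

noncomputable section

/-- `h'' + h ≥ 0` in the distributional sense on the circle: testing against every
nonnegative `2π`-periodic smooth function gives a nonnegative number. -/
def DistribConvexCirc (h : ℝ → ℝ) : Prop :=
  ∀ φ : ℝ → ℝ, ContDiff ℝ (⊤ : ℕ∞) φ → Function.Periodic φ (2 * π) → (∀ θ, 0 ≤ φ θ) →
    0 ≤ ∫ θ in (0:ℝ)..(2 * π), h θ * (deriv (deriv φ) θ + φ θ)

/-- `A(h) = (1/2)∫₀^{2π} (h² − h'²)`. -/
def Afun (h : ℝ → ℝ) : ℝ :=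
  (1 / 2) * ∫ θ in (0:ℝ)..(2 * π), ((h θ) ^ 2 - (deriv h θ) ^ 2)

/-- `B(h) = (1/2)∫₀^{2π} h⁻²`. -/
def Bfun (h : ℝ → ℝ) : ℝ :=
  (1 / 2) * ∫ θ in (0:ℝ)..(2 * π), ((h θ) ^ 2)⁻¹

/-- The second derivative at `t = 0` of `t ↦ A(h+tv)·B(h+tv)`:
`Q(v) = B(h)∫(v² − v'²) − 2(∫(hv − h'v'))(∫ v/h³) + 3A(h)∫ v²/h⁴`. -/
def Qform (h v : ℝ → ℝ) : ℝ :=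
  Bfun h * (∫ θ in (0:ℝ)..(2 * π), ((v θ) ^ 2 - (deriv v θ) ^ 2))
    - 2 * (∫ θ in (0:ℝ)..(2 * π), (h θ * v θ - deriv h θ * deriv v θ))
        * (∫ θ in (0:ℝ)..(2 * π), v θ / (h θ) ^ 3)
    + 3 * Afun h * ∫ θ in (0:ℝ)..(2 * π), (v θ) ^ 2 / (h θ) ^ 4

/-- The `L^∞`-norm of a `2π`-periodic continuous function. -/
def supNorm (v : ℝ → ℝ) : ℝ := sSup ((fun θ => |v θ|) '' Set.Icc (0:ℝ) (2 * π))

/-- The `L¹`-norm over one period. -/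
def l1Norm (v : ℝ → ℝ) : ℝ := ∫ θ in (0:ℝ)..(2 * π), |v θ|

theorem Continuous.abs_le_supNorm {v : ℝ → ℝ} (hv : Continuous v)
    (hper : Function.Periodic v (2 * π)) (θ : ℝ) : |v θ| ≤ supNorm v := by
  obtain ⟨y, hy, hvy⟩ := hper.exists_mem_Ico₀ two_pi_pos θ
  rw [hvy]
  exact le_csSup (isCompact_Icc.image hv.abs).bddAbove ⟨y, Ico_subset_Icc_self hy, rfl⟩

theorem Function.Periodic.deriv_periodic {f : ℝ → ℝ} {c : ℝ} (hf : Function.Periodic f c) :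
    Function.Periodic (deriv f) c := fun x => by
  rw [← deriv_comp_add_const, funext hf]

/-- Integration by parts on the circle for a Lipschitz function against a smooth one. -/
theorem integral_mul_sub_deriv_mul_deriv {h v : ℝ → ℝ} (hper : Function.Periodic h (2 * π))
    {L : NNReal} (hlip : LipschitzWith L h) (hv : ContDiff ℝ (⊤ : ℕ∞) v)
    (hvper : Function.Periodic v (2 * π)) :
    ∫ θ in (0:ℝ)..(2 * π), (h θ * v θ - deriv h θ * deriv v θ) =
      ∫ θ in (0:ℝ)..(2 * π), h θ * (deriv (deriv v) θ + v θ) := by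
  have hv' : ContDiff ℝ (⊤ : ℕ∞) (deriv v) := (contDiff_infty_iff_deriv.1 hv).2
  have hv'' : Continuous (deriv (deriv v)) := (contDiff_infty_iff_deriv.1 hv').2.continuous
  have hac : AbsolutelyContinuousOnInterval h 0 (2 * π) :=
    hlip.lipschitzOnWith.absolutelyContinuousOnInterval
  obtain ⟨K, hK⟩ := (hv'.of_le (by simp) : ContDiff ℝ 1 (deriv v)).contDiffOn
    |>.exists_lipschitzOnWith one_ne_zero (convex_uIcc 0 (2 * π)) isCompact_uIcc
  have hparts := hac.integral_mul_deriv_eq_deriv_mul hK.absolutelyContinuousOnInterval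
  have h0 : h (2 * π) = h 0 := by simpa using hper 0
  have hv0 : deriv v (2 * π) = deriv v 0 := by simpa using hvper.deriv_periodic 0
  have hhv : IntervalIntegrable (fun θ => h θ * v θ) volume 0 (2 * π) :=
    (hlip.continuous.mul hv.continuous).intervalIntegrable _ _
  have hhv' : IntervalIntegrable (fun θ => deriv h θ * deriv v θ) volume 0 (2 * π) :=
    hac.intervalIntegrable_deriv.mul_continuousOn hv'.continuous.continuousOn
  have hhv'' : IntervalIntegrable (fun θ => h θ * deriv (deriv v) θ) volume 0 (2 * π) :=
    (hlip.continuous.mul hv'').intervalIntegrable _ _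
  simp only [mul_add]
  rw [integral_sub hhv hhv', integral_add hhv'' hhv, hparts, h0, hv0]
  ring

/-- A distribution `h'' + h ≥ 0` is a positive functional, hence bounded for the sup norm. -/
theorem DistribConvexCirc.abs_integral_le {h v : ℝ → ℝ} (hconv : DistribConvexCirc h)
    (hh : Continuous h) (hv : ContDiff ℝ (⊤ : ℕ∞) v) (hper : Function.Periodic v (2 * π))
    {M : ℝ} (hM : ∀ θ, |v θ| ≤ M) :
    |∫ θ in (0:ℝ)..(2 * π), h θ * (deriv (deriv v) θ + v θ)| ≤
      M * ∫ θ in (0:ℝ)..(2 * π), h θ := by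
  have hv' : ContDiff ℝ (⊤ : ℕ∞) (deriv v) := (contDiff_infty_iff_deriv.1 hv).2
  have hv'' : Continuous (deriv (deriv v)) := (contDiff_infty_iff_deriv.1 hv').2.continuous
  have hint : IntervalIntegrable (fun θ => h θ * (deriv (deriv v) θ + v θ)) volume 0 (2 * π) :=
    (hh.mul (hv''.add hv.continuous)).intervalIntegrable _ _
  have hMint : IntervalIntegrable (fun θ => M * h θ) volume 0 (2 * π) :=
    (hh.const_mul M).intervalIntegrable _ _
  have hsub := hconv (fun θ => M - v θ) (contDiff_const.sub hv)
    (fun θ => by simp only [hper θ]) (fun θ => sub_nonneg.2 (abs_le.1 (hM θ)).2)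
  have hadd := hconv (fun θ => M + v θ) (contDiff_const.add hv)
    (fun θ => by simp only [hper θ]) (fun θ => by linarith [(abs_le.1 (hM θ)).1])
  have hd1 : deriv (fun θ => M - v θ) = fun θ => -deriv v θ := by
    ext θ; exact deriv_const_sub M
  have hd2 : deriv (fun θ => M + v θ) = deriv v := by
    ext θ; exact deriv_const_add M
  have e1 : (fun θ => h θ * (deriv (deriv fun θ => M - v θ) θ + (M - v θ))) =
      fun θ => M * h θ - h θ * (deriv (deriv v) θ + v θ) := by
    ext θ; rw [hd1, deriv.fun_neg]; ring
  have e2 : (fun θ => h θ * (deriv (deriv fun θ => M + v θ) θ + (M + v θ))) =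
      fun θ => M * h θ + h θ * (deriv (deriv v) θ + v θ) := by
    ext θ; rw [hd2]; ring
  rw [e1, integral_sub hMint hint, intervalIntegral.integral_const_mul] at hsub
  rw [e2, integral_add hMint hint, intervalIntegral.integral_const_mul] at hadd
  exact abs_le.2 ⟨by linarith, by linarith⟩

/-- Concavity estimate for the second derivative of the Mahler functional
(nonsymmetric case): for `h` a positive Lipschitz `2π`-periodic function with
`h'' + h ≥ 0` distributionally, one has `B(h) > 0` and there is `C = C(h) > 0` with
`Q(v) ≤ C‖v‖_∞‖v‖₁ − B(h)∫ v'²` for every smooth periodic `v`. -/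
theorem second_derivative_concavity
    (h : ℝ → ℝ) (hper : Function.Periodic h (2 * π)) (hlip : ∃ L, LipschitzWith L h)
    (hpos : ∀ θ, 0 < h θ) (hconv : DistribConvexCirc h) :
    0 < Bfun h ∧ ∃ C > 0, ∀ v : ℝ → ℝ, ContDiff ℝ (⊤ : ℕ∞) v → Function.Periodic v (2 * π) →
      Qform h v ≤ C * supNorm v * l1Norm v
        - Bfun h * ∫ θ in (0:ℝ)..(2 * π), (deriv v θ) ^ 2 := by
  obtain ⟨L, hL⟩ := hlip
  have hc : Continuous h := hL.continuous
  have hB : 0 < Bfun h := mul_pos (by norm_num) <| intervalIntegral_pos_of_pos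
    (((hc.pow 2).inv₀ fun θ => (pow_pos (hpos θ) 2).ne').intervalIntegrable _ _)
    (fun θ => inv_pos.2 (pow_pos (hpos θ) 2)) two_pi_pos
  have hI : 0 ≤ ∫ θ in (0:ℝ)..(2 * π), h θ :=
    integral_nonneg two_pi_pos.le fun θ _ => (hpos θ).le
  obtain ⟨m, hm, hmh⟩ : ∃ m > 0, ∀ θ ∈ Icc 0 (2 * π), m ≤ h θ := by
    obtain ⟨y, -, hy⟩ := isCompact_Icc.exists_isMinOn (nonempty_Icc.2 two_pi_pos.le)
      hc.continuousOn
    exact ⟨h y, hpos y, hy⟩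
  refine ⟨hB, Bfun h + 2 * (∫ θ in (0:ℝ)..(2 * π), h θ) / m ^ 3 + 3 * |Afun h| / m ^ 4,
    by positivity, fun v hv hvper => ?_⟩
  have hvc := hv.continuous
  have hsup := hvc.abs_le_supNorm hvper
  have hS : 0 ≤ supNorm v := (abs_nonneg _).trans (hsup 0)
  have hv2 : IntervalIntegrable (fun θ => v θ ^ 2) volume 0 (2 * π) :=
    (hvc.pow 2).intervalIntegrable _ _
  have hsq : ∫ θ in (0:ℝ)..(2 * π), v θ ^ 2 ≤ supNorm v * l1Norm v := by
    rw [l1Norm, ← intervalIntegral.integral_const_mul]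
    refine integral_mono two_pi_pos.le hv2 ((hvc.abs.const_mul _).intervalIntegrable _ _)
      fun θ => ?_
    simp only [← sq_abs (v θ), sq]
    exact mul_le_mul_of_nonneg_right (hsup θ) (abs_nonneg _)
  have hcube : |∫ θ in (0:ℝ)..(2 * π), v θ / h θ ^ 3| ≤ l1Norm v / m ^ 3 := by
    have hq : Continuous fun θ => v θ / h θ ^ 3 :=
      hvc.div (hc.pow 3) fun θ => (pow_pos (hpos θ) 3).ne'
    refine (abs_integral_le_integral_abs two_pi_pos.le).trans ?_
    rw [l1Norm, ← intervalIntegral.integral_div]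
    refine integral_mono_on two_pi_pos.le (hq.abs.intervalIntegrable _ _)
      ((hvc.abs.div_const _).intervalIntegrable _ _) fun θ hθ => ?_
    rw [abs_div, abs_of_pos (pow_pos (hpos θ) 3)]
    have := hmh θ hθ
    gcongr
  have hquart0 : 0 ≤ ∫ θ in (0:ℝ)..(2 * π), v θ ^ 2 / h θ ^ 4 :=
    integral_nonneg two_pi_pos.le fun θ _ => by positivity
  have hquart : ∫ θ in (0:ℝ)..(2 * π), v θ ^ 2 / h θ ^ 4 ≤ supNorm v * l1Norm v / m ^ 4 := by
    have hq : Continuous fun θ => v θ ^ 2 / h θ ^ 4 :=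
      (hvc.pow 2).div (hc.pow 4) fun θ => (pow_pos (hpos θ) 4).ne'
    refine le_trans ?_ (div_le_div_of_nonneg_right hsq (by positivity))
    rw [← intervalIntegral.integral_div]
    refine integral_mono_on two_pi_pos.le (hq.intervalIntegrable _ _)
      (hv2.div_const _) fun θ hθ => ?_
    have := hmh θ hθ
    gcongr
  have hv' : Continuous (deriv v) := (contDiff_infty_iff_deriv.1 hv).2.continuous
  have hderiv_sq : IntervalIntegrable (fun θ => deriv v θ ^ 2) volume 0 (2 * π) :=
    (hv'.pow 2).intervalIntegrable _ _
  have hmixed := hconv.abs_integral_le hc hv hvper hsup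
  rw [← integral_mul_sub_deriv_mul_deriv hper hL hv hvper] at hmixed
  rw [Qform, integral_sub hv2 hderiv_sq]
  have h1 := mul_le_mul_of_nonneg_left hsq hB.le
  have h2 := (neg_le_abs _).trans ((abs_mul _ _).trans_le
    (mul_le_mul hmixed hcube (abs_nonneg _) (mul_nonneg hS hI)))
  have h3 := mul_le_mul (le_abs_self (Afun h)) hquart hquart0 (abs_nonneg _)
  calc
    _ ≤ Bfun h * (supNorm v * l1Norm v)
        + 2 * (supNorm v * (∫ θ in (0:ℝ)..(2 * π), h θ) * (l1Norm v / m ^ 3))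
        + 3 * (|Afun h| * (supNorm v * l1Norm v / m ^ 4))
        - Bfun h * ∫ θ in (0:ℝ)..(2 * π), deriv v θ ^ 2 := by linarith
    _ = _ := by ring
end
end

section
/- Let h : ℝ → ℝ be 2π-periodic and Lipschitz with h'' + h ≥ 0 in the distributional sense. Then the derivative h' (defined a.e.) is a function of bounded variation on [0, 2π], and its total variation satisfies Var(h'; [0,2π]) ≤ 2∫₀^{2π} |h(θ)| dθ. -/
open MeasureTheory Real Set

noncomputable section

theorem hasDerivAt_integral_mul_comp_sub {k f f' : ℝ → ℝ} (hk : Continuous k)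
    (hf : ∀ x, HasDerivAt f (f' x) x) (hf' : Continuous f') (a b x₀ : ℝ) :
    HasDerivAt (fun x => ∫ t in a..b, k t * f (x - t)) (∫ t in a..b, k t * f' (x₀ - t)) x₀ := by
  have hfc : Continuous f := continuous_iff_continuousAt.2 fun x => (hf x).continuousAt
  obtain ⟨C, hC⟩ := ((isCompact_closedBall x₀ 1).prod (isCompact_uIcc (a := a) (b := b))
    ).exists_bound_of_continuousOn (f := fun q : ℝ × ℝ => k q.2 * f' (q.1 - q.2))
    (by fun_prop)
  refine (intervalIntegral.hasDerivAt_integral_of_dominated_loc_of_deriv_le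
    (F := fun x t => k t * f (x - t)) (F' := fun x t => k t * f' (x - t)) (bound := fun _ => C)
    (Metric.closedBall_mem_nhds x₀ one_pos)
    (Filter.Eventually.of_forall fun x => ?_) ?_ ?_ ?_ (by simp) ?_).2
  · exact Continuous.aestronglyMeasurable (by fun_prop)
  · exact Continuous.intervalIntegrable (by fun_prop) _ _
  · exact Continuous.aestronglyMeasurable (by fun_prop)
  · exact Filter.Eventually.of_forall fun t ht x hx => hC (x, t) ⟨hx, uIoc_subset_uIcc ht⟩
  · refine Filter.Eventually.of_forall fun t _ x _ => ?_
    have := ((hf (x - t)).comp_sub_const x t).const_mul (k t)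
    simpa using this

theorem integral_mul_comp_sub_of_periodic {p h : ℝ → ℝ} (hp : Function.Periodic p (2 * π))
    (hh : Function.Periodic h (2 * π)) (θ : ℝ) :
    ∫ t in (-π)..π, p t * h (θ - t) = ∫ s in (0:ℝ)..(2 * π), h s * p (θ - s) := by
  have hper : Function.Periodic (fun s => h s * p (θ - s)) (2 * π) := fun s => by
    have : p (θ - (s + 2 * π)) = p (θ - s) := by
      rw [← hp (θ - (s + 2 * π))]; congr 1; ring
    simp only [hh s, this]
  have h1 := intervalIntegral.integral_comp_sub_left (a := -π) (b := π)
    (fun s => h s * p (θ - s)) θ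
  have h2 := hper.intervalIntegral_add_eq (θ - π) 0
  rw [show θ - π + 2 * π = θ - -π by ring, zero_add] at h2
  rw [← h2, ← h1]
  exact intervalIntegral.integral_congr fun t _ => by simp [mul_comm]

theorem hasDerivAt_integral_of_continuous {h : ℝ → ℝ} (hc : Continuous h) (x : ℝ) :
    HasDerivAt (fun x => ∫ s in (0:ℝ)..x, h s) (h x) x :=
  intervalIntegral.integral_hasDerivAt_right (hc.intervalIntegrable _ _)
    hc.aestronglyMeasurable.stronglyMeasurableAtFilter hc.continuousAt

/-- The sum of `h` and its second antiderivative. Its second distributional derivative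
is `h'' + h`. -/
def addSecondPrimitive (h : ℝ → ℝ) (x : ℝ) : ℝ :=
  h x + ∫ u in (0:ℝ)..x, ∫ s in (0:ℝ)..u, h s

theorem hasDerivAt_secondPrimitive {h : ℝ → ℝ} (hc : Continuous h) (x : ℝ) :
    HasDerivAt (fun x => ∫ u in (0:ℝ)..x, ∫ s in (0:ℝ)..u, h s) (∫ s in (0:ℝ)..x, h s) x :=
  hasDerivAt_integral_of_continuous
    (continuous_iff_continuousAt.2 fun y => (hasDerivAt_integral_of_continuous hc y).continuousAt) x

/-- Smoothing `addSecondPrimitive h` with a nonnegative smooth periodic kernel gives a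
convex function. -/
theorem DistribConvexCirc.convexOn_integral_mul {h p : ℝ → ℝ} (hconv : DistribConvexCirc h)
    (hc : Continuous h) (hper : Function.Periodic h (2 * π))
    (hp : ContDiff ℝ (⊤ : ℕ∞) p) (hpper : Function.Periodic p (2 * π)) (hp0 : ∀ t, 0 ≤ p t) :
    ConvexOn ℝ univ (fun x => ∫ t in (-π)..π, p t * addSecondPrimitive h (x - t)) := by
  set H : ℝ → ℝ := fun x => ∫ s in (0:ℝ)..x, h s
  set J : ℝ → ℝ := fun x => ∫ u in (0:ℝ)..x, H u
  have hHd : ∀ x, HasDerivAt H (h x) x := hasDerivAt_integral_of_continuous hc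
  have hJd : ∀ x, HasDerivAt J (H x) x := hasDerivAt_secondPrimitive hc
  have hHc : Continuous H := continuous_iff_continuousAt.2 fun x => (hHd x).continuousAt
  have hJc : Continuous J := continuous_iff_continuousAt.2 fun x => (hJd x).continuousAt
  have hpc : Continuous p := hp.continuous
  have hp1 : ContDiff ℝ (⊤ : ℕ∞) (deriv p) := (contDiff_infty_iff_deriv.1 hp).2
  have hp2 : ContDiff ℝ (⊤ : ℕ∞) (deriv (deriv p)) := (contDiff_infty_iff_deriv.1 hp1).2
  have hpd : ∀ x, HasDerivAt p (deriv p x) x :=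
    fun x => (hp.differentiable (by simp) x).hasDerivAt
  have hpd1 : ∀ x, HasDerivAt (deriv p) (deriv (deriv p) x) x :=
    fun x => (hp1.differentiable (by simp) x).hasDerivAt
  have hsplit : (fun x => ∫ t in (-π)..π, p t * addSecondPrimitive h (x - t)) =
      fun x => (∫ s in (0:ℝ)..(2 * π), h s * p (x - s)) + ∫ t in (-π)..π, p t * J (x - t) := by
    funext x
    rw [← integral_mul_comp_sub_of_periodic hpper hper, ← intervalIntegral.integral_add
      (Continuous.intervalIntegrable (by fun_prop) _ _)
      (Continuous.intervalIntegrable (by fun_prop) _ _)]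
    exact intervalIntegral.integral_congr fun t _ => mul_add _ _ _
  rw [hsplit]
  have hd1 : ∀ x, HasDerivAt
      (fun x => (∫ s in (0:ℝ)..(2 * π), h s * p (x - s)) + ∫ t in (-π)..π, p t * J (x - t))
      ((∫ s in (0:ℝ)..(2 * π), h s * deriv p (x - s)) + ∫ t in (-π)..π, p t * H (x - t)) x :=
    fun x => (hasDerivAt_integral_mul_comp_sub hc hpd hp1.continuous _ _ x).add
      (hasDerivAt_integral_mul_comp_sub hpc hJd hHc _ _ x)
  have hd2 : ∀ x, HasDerivAt
      (fun x => (∫ s in (0:ℝ)..(2 * π), h s * deriv p (x - s)) + ∫ t in (-π)..π, p t * H (x - t))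
      ((∫ s in (0:ℝ)..(2 * π), h s * deriv (deriv p) (x - s)) +
        ∫ t in (-π)..π, p t * h (x - t)) x :=
    fun x => (hasDerivAt_integral_mul_comp_sub hc hpd1 hp2.continuous _ _ x).add
      (hasDerivAt_integral_mul_comp_sub hpc hHd hc _ _ x)
  have hderiv := funext fun x => (hd1 x).deriv
  refine convexOn_univ_of_deriv2_nonneg (fun x => (hd1 x).differentiableAt) ?_ fun x => ?_
  · rw [hderiv]
    exact fun x => (hd2 x).differentiableAt
  · rw [Function.iterate_succ, Function.iterate_one, Function.comp_apply, hderiv, (hd2 x).deriv,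
      integral_mul_comp_sub_of_periodic hpper hper]
    have hp2c := hp2.continuous
    rw [← intervalIntegral.integral_add (Continuous.intervalIntegrable (by fun_prop) _ _)
      (Continuous.intervalIntegrable (by fun_prop) _ _)]
    have hφ : deriv (deriv fun s => p (x - s)) = fun s => deriv (deriv p) (x - s) := by
      have e1 : (deriv fun s => p (x - s)) = fun s => -deriv p (x - s) :=
        funext fun s => deriv_comp_const_sub p x s
      rw [e1]
      funext s
      rw [deriv.fun_neg, deriv_comp_const_sub, neg_neg]
    have := hconv (fun s => p (x - s)) (by fun_prop)
      (fun s => by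
        show p (x - (s + 2 * π)) = p (x - s)
        rw [← hpper (x - (s + 2 * π))]; congr 1; ring)
      (fun s => hp0 _)
    simpa only [hφ, mul_add] using this

theorem DistribConvexCirc.convexOn_addSecondPrimitive {h : ℝ → ℝ} (hconv : DistribConvexCirc h)
    (hc : Continuous h) (hper : Function.Periodic h (2 * π)) :
    ConvexOn ℝ univ (addSecondPrimitive h) := by
  have hKc : Continuous (addSecondPrimitive h) := hc.add
    (continuous_iff_continuousAt.2 fun y => (hasDerivAt_secondPrimitive hc y).continuousAt)
  set c : ℝ → ℝ := fun t => 1 + cos t with hcdef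
  have hc0 : ∀ t, 0 ≤ c t := fun t => by have := neg_one_le_cos t; simp only [hcdef]; linarith
  set w : ℕ → ℝ := fun n => (∫ t in Icc (-π) π, c t ^ n)⁻¹
  have hw : ∀ n, 0 ≤ w n := fun n =>
    inv_nonneg.2 (integral_nonneg fun t => pow_nonneg (hc0 t) n)
  have htend : ∀ x, Filter.Tendsto
      (fun n => w n * ∫ t in (-π)..π, c t ^ n * addSecondPrimitive h (x - t)) Filter.atTop
      (nhds (addSecondPrimitive h x)) := fun x => by
    have := tendsto_setIntegral_pow_smul_of_unique_maximum_of_isCompact_of_continuousOn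
      (μ := volume) (isCompact_Icc (a := -π) (b := π)) (x₀ := 0) (c := c)
      (g := fun t => addSecondPrimitive h (x - t)) (by fun_prop)
      (fun y hy hy0 => by
        have h1 : cos y ≠ 1 := fun h1 => hy0
          ((cos_eq_one_iff_of_lt_of_lt (by linarith [hy.1, pi_pos])
            (by linarith [hy.2, pi_pos])).1 h1)
        have h2 := lt_of_le_of_ne (cos_le_one y) h1
        simpa [hcdef] using h2)
      (fun y _ => hc0 y) (by simp [hcdef])
      (by
        rw [interior_Icc]
        exact subset_closure ⟨by linarith [pi_pos], pi_pos⟩)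
      (by fun_prop)
    simpa only [smul_eq_mul, sub_zero, integral_Icc_eq_integral_Ioc,
      ← intervalIntegral.integral_of_le (show -π ≤ π by linarith [pi_pos]), w] using this
  have hcvx : ∀ n, ConvexOn ℝ univ
      (fun x => w n * ∫ t in (-π)..π, c t ^ n * addSecondPrimitive h (x - t)) := fun n =>
    (hconv.convexOn_integral_mul hc hper (p := fun t => c t ^ n) (by fun_prop)
      (fun t => by simp [hcdef]) (fun t => pow_nonneg (hc0 t) n)).smul (hw n)
  refine ⟨convex_univ, fun x _ y _ a b ha hb hab => ?_⟩
  exact le_of_tendsto_of_tendsto' (htend _) (((htend x).const_smul a).add ((htend y).const_smul b))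
    fun n => (hcvx n).2 (mem_univ x) (mem_univ y) ha hb hab

open scoped Pointwise in
theorem periodic_derivWithin_Ioi {f : ℝ → ℝ} {T : ℝ} (hf : Function.Periodic f T) :
    Function.Periodic (fun x => derivWithin f (Ioi x) x) T := fun x => by
  have h := derivWithin_comp_add_const (f := f) (s := Ioi x) (a := T) (x := x)
  have hset : T +ᵥ Ioi x = Ioi (x + T) := by
    ext y
    simp [mem_vadd_set_iff_neg_vadd_mem, add_comm]
  rw [hset, funext hf] at h
  exact h.symm

theorem eVariationOn_le_of_edist_le {α E F : Type*} [LinearOrder α] [PseudoEMetricSpace E]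
    [PseudoEMetricSpace F] {f : α → E} {g : α → F} {s : Set α}
    (hfg : ∀ x ∈ s, ∀ y ∈ s, edist (f x) (f y) ≤ edist (g x) (g y)) :
    eVariationOn f s ≤ eVariationOn g s :=
  iSup_mono fun p => Finset.sum_le_sum fun _ _ => hfg _ (p.2.2.2 _) _ (p.2.2.2 _)

/-- For a `2π`-periodic Lipschitz `h` with `h'' + h ≥ 0` distributionally, the a.e.
derivative `h'` has a representative of bounded variation on `[0, 2π]`, with total
variation at most `2∫₀^{2π} |h|`. -/
theorem deriv_boundedVariation_of_distribConvex
    (h : ℝ → ℝ) (hper : Function.Periodic h (2 * π)) (hlip : ∃ L, LipschitzWith L h)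
    (hconv : DistribConvexCirc h) :
    ∃ g : ℝ → ℝ,
      (∀ᵐ θ ∂(volume.restrict (Set.Icc (0:ℝ) (2 * π))), deriv h θ = g θ) ∧
      BoundedVariationOn g (Set.Icc (0:ℝ) (2 * π)) ∧
      (eVariationOn g (Set.Icc (0:ℝ) (2 * π))).toReal
        ≤ 2 * ∫ θ in (0:ℝ)..(2 * π), |h θ| := by
  obtain ⟨L, hL⟩ := hlip
  have hc : Continuous h := hL.continuous
  have hcvx := hconv.convexOn_addSecondPrimitive hc hper
  set g : ℝ → ℝ := fun x => derivWithin h (Ioi x) x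
  set H : ℝ → ℝ := fun x => ∫ s in (0:ℝ)..x, h s with hH
  set A : ℝ → ℝ := fun x => ∫ s in (0:ℝ)..x, |h s| with hA
  set m : ℝ → ℝ := fun x => derivWithin (addSecondPrimitive h) (Ioi x) x
  have hmono : Monotone m := by
    have := hcvx.monotoneOn_rightDeriv
    rwa [interior_univ, monotoneOn_univ] at this
  have hgm : ∀ x, g x = m x - H x := fun x => by
    have h1 := (hcvx.hasDerivWithinAt_rightDeriv_of_mem_interior (x := x) (by simp)).sub
      (hasDerivAt_secondPrimitive hc x).hasDerivWithinAt
    refine HasDerivWithinAt.derivWithin (h1.congr_of_eventuallyEq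
      (Filter.Eventually.of_forall fun y => ?_) ?_) (uniqueDiffWithinAt_Ioi x) <;>
    simp [addSecondPrimitive]
  have hgper : g (2 * π) = g 0 := by
    simpa using periodic_derivWithin_Ioi hper 0
  have hle : ∀ x y, x ≤ y → |H y - H x| ≤ A y - A x := fun x y hxy => by
    have hi : ∀ a b, IntervalIntegrable h volume a b := fun a b => hc.intervalIntegrable a b
    have hi' : ∀ a b, IntervalIntegrable (fun s => |h s|) volume a b :=
      fun a b => hc.abs.intervalIntegrable a b
    simp only [hH, hA, intervalIntegral.integral_interval_sub_left (hi _ _) (hi _ _),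
      intervalIntegral.integral_interval_sub_left (hi' _ _) (hi' _ _)]
    exact intervalIntegral.abs_integral_le_integral_abs hxy
  have hMmono : Monotone (fun x => m x + A x) := fun x y hxy => by
    have := (abs_nonneg _).trans (hle x y hxy)
    have := hmono hxy
    show m x + A x ≤ m y + A y
    linarith
  have hdist : ∀ x y, x ≤ y → |g x - g y| ≤ |(m x + A x) - (m y + A y)| := fun x y hxy => by
    have h1 := abs_le.1 (hle x y hxy)
    have h2 := hmono hxy
    rw [abs_sub_comm (m x + A x), hgm, hgm]
    refine le_trans (abs_le.2 ⟨?_, ?_⟩) (le_abs_self _) <;> linarith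
  have hvar : eVariationOn g (Icc 0 (2 * π)) ≤
      ENNReal.ofReal ((m (2 * π) + A (2 * π)) - (m 0 + A 0)) := by
    have h0 : (0:ℝ) ≤ 2 * π := by positivity
    refine (eVariationOn_le_of_edist_le (g := fun x => m x + A x) fun x _ y _ => ?_).trans
      ((eVariationOn.mono _ (subset_inter subset_rfl subset_rfl)).trans
        ((hMmono.monotoneOn (Icc 0 (2 * π))).eVariationOn_eq (left_mem_Icc.2 h0)
          (right_mem_Icc.2 h0)).le)
    rw [edist_dist, edist_dist, Real.dist_eq, Real.dist_eq]
    refine ENNReal.ofReal_le_ofReal ?_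
    rcases le_total x y with hxy | hxy
    · exact hdist x y hxy
    · rw [abs_sub_comm (g x), abs_sub_comm (m x + A x)]
      exact hdist y x hxy
  refine ⟨g, ?_, ne_top_of_le_ne_top ENNReal.ofReal_ne_top hvar, ?_⟩
  · refine ae_restrict_of_ae ?_
    filter_upwards [hL.ae_differentiableAt_real] with x hx
    exact (hx.hasDerivAt.hasDerivWithinAt.derivWithin (uniqueDiffWithinAt_Ioi x)).symm
  · refine ENNReal.toReal_le_of_le_ofReal ?_ (hvar.trans (ENNReal.ofReal_le_ofReal ?_))
    · have : 0 ≤ ∫ θ in (0:ℝ)..(2 * π), |h θ| :=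
        intervalIntegral.integral_nonneg (by positivity) fun _ _ => abs_nonneg _
      positivity
    · have h1 := hgm (2 * π)
      have h2 := hgm 0
      have h3 := (abs_le.1 (hle 0 (2 * π) (by positivity))).2
      have h4 : A 0 = 0 := by simp [hA]
      have h5 : A (2 * π) = ∫ θ in (0:ℝ)..(2 * π), |h θ| := rfl
      linarith
end
end
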